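/- Let (K_i, i ∈ L) be auxiliary random variables jointly distributed with the sources (Y_s, s ∈ S) via an arbitrary conditional distribution P_{K_L | Y_S}. If the link capacity tuple C = (C_e, e ∈ E) is achievable, then there exists a polymatroid h on the ground set S ∪ E ∪ L such that: (i) h(α ∪ β) = H(Y_s, s ∈ α; K_i, i ∈ β) for every α ⊆ S and β ⊆ L; (ii) h(e | {f ∈ S ∪ E : f → e}) = 0 for every e ∈ E; (iii) h(s | {s' ∈ S : u ∈ a(s')} ∪ {f ∈ E : f → u}) = 0 for every s ∈ S and u ∈ b(s); and (iv) h(e) ≤ C_e for every e ∈ E. Hence the improved outer bound satisfies R_cs ⊆ R*_cs(Γ) ⊆ R_cs(Γ). -/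

import Mathlib

open scoped BigOperators

/-- Probability of an event under a pmf `μ` on a finite outcome space. -/
noncomputable def probOf {Ω : Type*} [Fintype Ω] (μ : Ω → ℝ) (E : Set Ω) : ℝ :=
  ∑ ω, E.indicator μ ω

/-- Shannon entropy (in bits) of the random variable `X` on the finite
probability space `(Ω, μ)`. -/
noncomputable def shEntropy {Ω : Type*} {S : Type*} [Fintype Ω] (μ : Ω → ℝ) (X : Ω → S) : ℝ :=
  ∑ ω, μ ω * (- Real.logb 2 (probOf μ {ω' | X ω' = X ω}))

/-- Conditional Shannon entropy `H(Y | X)` (in bits). -/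
noncomputable def shCondEntropy {Ω S T : Type*} [Fintype Ω] (μ : Ω → ℝ)
    (Y : Ω → T) (X : Ω → S) : ℝ :=
  shEntropy μ (fun ω => (X ω, Y ω)) - shEntropy μ X

/-- The support of the random variable `X` (values taken with positive probability). -/
noncomputable def rvSupport {Ω S : Type*} [Fintype Ω] (μ : Ω → ℝ) (X : Ω → S) : Finset S := by
  classical exact (Finset.univ.filter fun ω => 0 < μ ω).image X

/-- `μ` is a probability mass function. -/
def IsPMF {Ω : Type*} [Fintype Ω] (μ : Ω → ℝ) : Prop :=
  (∀ ω, 0 ≤ μ ω) ∧ ∑ ω, μ ω = 1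

/-- A polymatroid on the finite ground set `Z`. -/
def IsPolymatroid {Z : Type*} [DecidableEq Z] (h : Finset Z → ℝ) : Prop :=
  h ∅ = 0 ∧ (∀ A : Finset Z, 0 ≤ h A) ∧ (∀ A B : Finset Z, A ⊆ B → h A ≤ h B) ∧
    ∀ A B : Finset Z, h (A ∩ B) + h (A ∪ B) ≤ h A + h B
/-- A network: a directed acyclic graph with error-free point-to-point links,
source-location map `src` and demand map `snk`. Acyclicity is witnessed by a
topological ordering of the nodes. -/
structure Network (V S E : Type) where
  tail : E → V
  head : E → V
  src : S → Set V
  snk : S → Set V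
  disj : ∀ s, src s ∩ snk s = ∅
  ord : V → ℕ
  acyclic : ∀ e, ord (tail e) < ord (head e)

/-- A block-`N` network code: finite edge alphabets, global edge messages `g`
which are locally encodable (each edge message is a function of the source
blocks available at its tail and of the messages on incoming edges), and
decoding functions at every node. -/
structure NetworkCode {V S E : Type} (net : Network V S E) (𝒴 : S → Type) (N : ℕ) where
  U : E → Type
  fintU : ∀ e, Fintype (U e)
  g : (e : E) → ((s : S) → Fin N → 𝒴 s) → U e
  localEnc : ∀ e : E,
    ∃ φ : ((s : {s : S // net.tail e ∈ net.src s}) → Fin N → 𝒴 s.1) →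
          ((f : {f : E // net.head f = net.tail e}) → U f.1) → U e,
      ∀ y, g e y = φ (fun s => y s.1) (fun f => g f.1 y)
  dec : (s : S) → (u : V) →
    ((s' : {s' : S // u ∈ net.src s'}) → Fin N → 𝒴 s'.1) →
    ((f : {f : E // net.head f = u}) → U f.1) → (Fin N → 𝒴 s)

/-- The error probability at sink `u` for source `s`, when the sources are
i.i.d. (over time) with single-letter joint pmf `p`. -/
noncomputable def errProb {V S E : Type} [Fintype S] [DecidableEq S]
    (net : Network V S E) {𝒴 : S → Type} [∀ s, Fintype (𝒴 s)]
    (p : (∀ s, 𝒴 s) → ℝ) {N : ℕ} (code : NetworkCode net 𝒴 N) (s : S) (u : V) : ℝ :=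
  probOf (fun y : Fin N → (∀ s, 𝒴 s) => ∏ n, p (y n))
    {y | code.dec s u (fun s' n => y n s'.1)
          (fun f => code.g f.1 (fun s'' n => y n s'')) ≠ fun n => y n s}

/-- Achievability of a link capacity tuple `C`: there are block codes of
arbitrarily large blocklength whose rates are within `ε` of `C` and whose
error probabilities at all sinks are at most `ε`. -/
def Achievable {V S E : Type} [Fintype S] [DecidableEq S]
    (net : Network V S E) (𝒴 : S → Type) [∀ s, Fintype (𝒴 s)]
    (p : (∀ s, 𝒴 s) → ℝ) (C : E → ℝ) : Prop :=
  ∀ ε : ℝ, 0 < ε → ∃ N : ℕ, 0 < N ∧ ∃ code : NetworkCode net 𝒴 N,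
    (∀ e : E, Real.logb 2 (@Fintype.card (code.U e) (code.fintU e)) / N ≤ C e + ε) ∧
    ∀ s : S, ∀ u ∈ net.snk s, errProb net p code s u ≤ ε

/-- Ground-set elements `{f ∈ S ∪ E : f → e}` inside `S ⊕ E ⊕ L`. -/
noncomputable def inEdges' {V S E L : Type} [Fintype S] [Fintype E]
    [DecidableEq S] [DecidableEq E] [DecidableEq L]
    (net : Network V S E) (e : E) : Finset (S ⊕ E ⊕ L) := by
  classical
  exact (Finset.univ.filter fun s : S => net.tail e ∈ net.src s).image Sum.inl ∪
    (Finset.univ.filter fun f : E => net.head f = net.tail e).image (Sum.inr ∘ Sum.inl)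

/-- Ground-set elements available at node `u`, inside `S ⊕ E ⊕ L`. -/
noncomputable def atNode' {V S E L : Type} [Fintype S] [Fintype E]
    [DecidableEq S] [DecidableEq E] [DecidableEq L]
    (net : Network V S E) (u : V) : Finset (S ⊕ E ⊕ L) := by
  classical
  exact (Finset.univ.filter fun s : S => u ∈ net.src s).image Sum.inl ∪
    (Finset.univ.filter fun f : E => net.head f = u).image (Sum.inr ∘ Sum.inl)

section Entropy

variable {Ω S T R : Type*} [Fintype Ω] {μ : Ω → ℝ}

theorem probOf_setOf (μ : Ω → ℝ) (P : Ω → Prop) [DecidablePred P] :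
    probOf μ {ω | P ω} = ∑ ω, if P ω then μ ω else 0 := by
  classical
  simp only [probOf, Set.indicator_apply, Set.mem_ofPred_eq]

theorem probOf_nonneg (hμ : ∀ ω, 0 ≤ μ ω) (A : Set Ω) : 0 ≤ probOf μ A :=
  Finset.sum_nonneg fun _ _ => Set.indicator_nonneg (fun ω _ => hμ ω) _

theorem probOf_mono (hμ : ∀ ω, 0 ≤ μ ω) {A B : Set Ω} (hAB : A ⊆ B) :
    probOf μ A ≤ probOf μ B :=
  Finset.sum_le_sum fun _ _ => Set.indicator_le_indicator_of_subset hAB hμ _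

theorem le_probOf (hμ : ∀ ω, 0 ≤ μ ω) {A : Set Ω} {ω : Ω} (hω : ω ∈ A) :
    μ ω ≤ probOf μ A := by
  rw [probOf, ← Set.indicator_of_mem hω μ]
  exact Finset.single_le_sum (f := fun ω => A.indicator μ ω)
    (fun ω' _ => Set.indicator_nonneg (fun ω _ => hμ ω) ω') (Finset.mem_univ ω)

theorem probOf_le_one (hμ : IsPMF μ) (A : Set Ω) : probOf μ A ≤ 1 := by
  rw [← hμ.2]
  exact Finset.sum_le_sum fun ω _ => Set.indicator_le_self' (fun _ _ => hμ.1 _) ω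

theorem probOf_fiber_pos (hμ : ∀ ω, 0 ≤ μ ω) (X : Ω → S) {ω : Ω} (hω : 0 < μ ω) :
    0 < probOf μ {ω' | X ω' = X ω} :=
  hω.trans_le (le_probOf hμ rfl)

theorem shEntropy_congr {X : Ω → S} {Y : Ω → T}
    (h : ∀ ω ω', X ω' = X ω ↔ Y ω' = Y ω) : shEntropy μ X = shEntropy μ Y := by
  simp only [shEntropy, h]

theorem shEntropy_nonneg (hμ : IsPMF μ) (X : Ω → S) : 0 ≤ shEntropy μ X :=
  Finset.sum_nonneg fun ω _ => mul_nonneg (hμ.1 ω) <| neg_nonneg.2 <|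
    Real.logb_nonpos one_lt_two (probOf_nonneg hμ.1 _) (probOf_le_one hμ _)

theorem shEntropy_eq_zero_of_const (hμ : IsPMF μ) {X : Ω → S} (h : ∀ ω ω', X ω' = X ω) :
    shEntropy μ X = 0 := by
  have h1 : probOf μ Set.univ = 1 := by simp [probOf, hμ.2]
  have h2 : ∀ ω, {ω' | X ω' = X ω} = Set.univ := fun ω => Set.eq_univ_of_forall (h ω)
  simp [shEntropy, h2, h1]

theorem shEntropy_mono (hμ : IsPMF μ) {X : Ω → S} {Y : Ω → T}
    (h : ∀ ω ω', Y ω' = Y ω → X ω' = X ω) : shEntropy μ X ≤ shEntropy μ Y := by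
  refine Finset.sum_le_sum fun ω _ => ?_
  rcases (hμ.1 ω).eq_or_lt with h0 | h0
  · simp [← h0]
  · refine mul_le_mul_of_nonneg_left (neg_le_neg ?_) h0.le
    exact Real.logb_le_logb_of_le one_lt_two (probOf_fiber_pos hμ.1 Y h0)
      (probOf_mono hμ.1 fun ω' => h ω ω')

/-- Gibbs' inequality. -/
theorem sum_mul_logb_nonpos (hμ : IsPMF μ) {w : Ω → ℝ} (hw : ∀ ω, 0 < μ ω → 0 < w ω)
    (hsum : ∑ ω, μ ω * w ω ≤ 1) : ∑ ω, μ ω * Real.logb 2 (w ω) ≤ 0 := by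
  have hlog2 : 0 < Real.log 2 := Real.log_pos one_lt_two
  calc ∑ ω, μ ω * Real.logb 2 (w ω) ≤ ∑ ω, (μ ω * w ω - μ ω) / Real.log 2 := by
        refine Finset.sum_le_sum fun ω _ => ?_
        rcases (hμ.1 ω).eq_or_lt with h0 | h0
        · simp [← h0]
        · rw [Real.logb, ← mul_div_assoc]
          refine div_le_div_of_nonneg_right ?_ hlog2.le
          nlinarith [Real.log_le_sub_one_of_pos (hw ω h0)]
    _ = (∑ ω, μ ω * w ω - 1) / Real.log 2 := by
        rw [← Finset.sum_div, Finset.sum_sub_distrib, hμ.2]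
    _ ≤ 0 := div_nonpos_of_nonpos_of_nonneg (by linarith) hlog2.le

open Classical in
theorem sum_fiber_div_probOf_le_one (μ : Ω → ℝ) (X : Ω → S) (x : S) :
    ∑ ω, (if X ω = x then μ ω / probOf μ {ω' | X ω' = X ω} else 0) ≤ 1 := by
  have h : ∀ ω, (if X ω = x then μ ω / probOf μ {ω' | X ω' = X ω} else 0) =
      (if X ω = x then μ ω else 0) / probOf μ {ω' | X ω' = x} := by
    intro ω
    split_ifs with hx
    · rw [hx]
    · simp
  rw [Finset.sum_congr rfl fun ω _ => h ω, ← Finset.sum_div, ← probOf_setOf]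
  exact div_self_le_one _

open Classical in
theorem shEntropy_submodular (hμ : IsPMF μ) {X : Ω → S} {Y : Ω → T} {Z : Ω → R}
    (hX : ∀ ω ω', X ω' = X ω → Z ω' = Z ω) (hY : ∀ ω ω', Y ω' = Y ω → Z ω' = Z ω) :
    shEntropy μ Z + shEntropy μ (fun ω => (X ω, Y ω)) ≤ shEntropy μ X + shEntropy μ Y := by
  set W : Ω → S × T := fun ω => (X ω, Y ω)
  set w : Ω → ℝ := fun ω => probOf μ {ω' | X ω' = X ω} * probOf μ {ω' | Y ω' = Y ω} /
    (probOf μ {ω' | W ω' = W ω} * probOf μ {ω' | Z ω' = Z ω}) with hw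
  have hpos : ∀ ω, 0 < μ ω → 0 < w ω := fun ω h => div_pos
    (mul_pos (probOf_fiber_pos hμ.1 X h) (probOf_fiber_pos hμ.1 Y h))
    (mul_pos (probOf_fiber_pos hμ.1 W h) (probOf_fiber_pos hμ.1 Z h))
  have hsum : ∑ ω, μ ω * w ω ≤ 1 := by
    have expand : ∀ ω, μ ω * w ω = ∑ ω₁, ∑ ω₂, (if X ω = X ω₁ ∧ Y ω = Y ω₂ then
        μ ω / probOf μ {ω' | W ω' = W ω} else 0) *
          (if Z ω₂ = Z ω₁ then μ ω₁ * μ ω₂ / probOf μ {ω' | Z ω' = Z ω₁} else 0) := by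
      intro ω
      have : μ ω * w ω = (μ ω / probOf μ {ω' | W ω' = W ω} / probOf μ {ω' | Z ω' = Z ω}) *
          (probOf μ {ω' | X ω' = X ω} * probOf μ {ω' | Y ω' = Y ω}) := by
        simp only [hw]; ring
      rw [this, probOf_setOf μ (fun ω' => X ω' = X ω), probOf_setOf μ (fun ω' => Y ω' = Y ω),
        Finset.sum_mul_sum, Finset.mul_sum]
      refine Finset.sum_congr rfl fun ω₁ _ => ?_
      rw [Finset.mul_sum]
      refine Finset.sum_congr rfl fun ω₂ _ => ?_
      by_cases h1 : X ω₁ = X ω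
      · by_cases h2 : Y ω₂ = Y ω
        · have hz1 := hX _ _ h1
          have hz2 := hY _ _ h2
          simp only [h1, h2, hz1, hz2, and_self, if_true]
          ring
        · simp [h2, Ne.symm h2]
      · simp [h1, Ne.symm h1]
    calc ∑ ω, μ ω * w ω
        = ∑ ω₁, ∑ ω₂, (∑ ω, if X ω = X ω₁ ∧ Y ω = Y ω₂ then
        μ ω / probOf μ {ω' | W ω' = W ω} else 0) *
          (if Z ω₂ = Z ω₁ then μ ω₁ * μ ω₂ / probOf μ {ω' | Z ω' = Z ω₁} else 0) := by
          rw [Finset.sum_congr rfl fun ω _ => expand ω, Finset.sum_comm]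
          refine Finset.sum_congr rfl fun ω₁ _ => ?_
          rw [Finset.sum_comm]
          exact Finset.sum_congr rfl fun ω₂ _ => (Finset.sum_mul _ _ _).symm
      _ ≤ ∑ ω₁, ∑ ω₂,
          (if Z ω₂ = Z ω₁ then μ ω₁ * μ ω₂ / probOf μ {ω' | Z ω' = Z ω₁} else 0) := by
          refine Finset.sum_le_sum fun ω₁ _ => Finset.sum_le_sum fun ω₂ _ => ?_
          refine mul_le_of_le_one_left ?_ ?_
          · split_ifs
            · exact div_nonneg (mul_nonneg (hμ.1 _) (hμ.1 _)) (probOf_nonneg hμ.1 _)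
            · exact le_rfl
          · have := sum_fiber_div_probOf_le_one μ W (X ω₁, Y ω₂)
            simpa only [W, Prod.mk.injEq] using this
      _ ≤ ∑ ω₁, μ ω₁ := by
          refine Finset.sum_le_sum fun ω₁ _ => ?_
          have : ∀ ω₂, (if Z ω₂ = Z ω₁ then μ ω₁ * μ ω₂ / probOf μ {ω' | Z ω' = Z ω₁} else 0) =
              μ ω₁ * ((if Z ω₂ = Z ω₁ then μ ω₂ else 0) / probOf μ {ω' | Z ω' = Z ω₁}) := by
            intro ω₂
            split_ifs <;> ring
          rw [Finset.sum_congr rfl fun ω₂ _ => this ω₂, ← Finset.mul_sum, ← Finset.sum_div,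
            ← probOf_setOf]
          exact mul_le_of_le_one_right (hμ.1 _) (div_self_le_one _)
      _ = 1 := hμ.2
  have key := sum_mul_logb_nonpos hμ hpos hsum
  have split : ∑ ω, μ ω * Real.logb 2 (w ω) =
      shEntropy μ Z + shEntropy μ W - (shEntropy μ X + shEntropy μ Y) := by
    simp only [shEntropy, ← Finset.sum_add_distrib, ← Finset.sum_sub_distrib]
    refine Finset.sum_congr rfl fun ω _ => ?_
    rcases (hμ.1 ω).eq_or_lt with h0 | h0
    · simp [← h0]
    · have hx := (probOf_fiber_pos hμ.1 X h0).ne'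
      have hy := (probOf_fiber_pos hμ.1 Y h0).ne'
      have hz := (probOf_fiber_pos hμ.1 Z h0).ne'
      have hxy := (probOf_fiber_pos hμ.1 W h0).ne'
      simp only [hw]
      rw [Real.logb_div (mul_ne_zero hx hy) (mul_ne_zero hxy hz), Real.logb_mul hx hy,
        Real.logb_mul hxy hz]
      ring
  linarith

open Classical in
/-- Conditional entropy is at most the cross entropy with respect to any positive
(sub-)stochastic kernel `r`. -/
theorem shCondEntropy_le_sum_neg_logb [Fintype T] (hμ : IsPMF μ) (X : Ω → T) (Z : Ω → R)
    {r : T → Ω → ℝ} (hr : ∀ x ω, 0 < r x ω) (hr1 : ∀ ω, ∑ x, r x ω ≤ 1)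
    (hrZ : ∀ x ω ω', Z ω' = Z ω → r x ω' = r x ω) :
    shCondEntropy μ X Z ≤ ∑ ω, μ ω * -Real.logb 2 (r (X ω) ω) := by
  set W : Ω → R × T := fun ω => (Z ω, X ω) with hW
  set w : Ω → ℝ := fun ω => r (X ω) ω * probOf μ {ω' | Z ω' = Z ω} /
    probOf μ {ω' | W ω' = W ω} with hw
  have hpos : ∀ ω, 0 < μ ω → 0 < w ω := fun ω h => div_pos
    (mul_pos (hr _ _) (probOf_fiber_pos hμ.1 Z h)) (probOf_fiber_pos hμ.1 W h)
  have hsum : ∑ ω, μ ω * w ω ≤ 1 := by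
    have expand : ∀ ω, μ ω * w ω = ∑ ω₁, ∑ x, (if Z ω = Z ω₁ ∧ X ω = x then
        μ ω / probOf μ {ω' | W ω' = W ω} else 0) * (μ ω₁ * r x ω₁) := by
      intro ω
      have : μ ω * w ω = (μ ω / probOf μ {ω' | W ω' = W ω} * r (X ω) ω) *
          probOf μ {ω' | Z ω' = Z ω} := by
        simp only [hw]; ring
      rw [this, probOf_setOf μ (fun ω' => Z ω' = Z ω), Finset.mul_sum]
      refine Finset.sum_congr rfl fun ω₁ _ => ?_
      by_cases h1 : Z ω₁ = Z ω
      · simp only [h1, true_and, if_true, ite_mul, zero_mul, Finset.sum_ite_eq,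
          Finset.mem_univ, hrZ _ _ _ h1]
        ring
      · simp [h1, Ne.symm h1]
    calc ∑ ω, μ ω * w ω
        = ∑ ω₁, ∑ x, (∑ ω, if Z ω = Z ω₁ ∧ X ω = x then
            μ ω / probOf μ {ω' | W ω' = W ω} else 0) * (μ ω₁ * r x ω₁) := by
          rw [Finset.sum_congr rfl fun ω _ => expand ω, Finset.sum_comm]
          refine Finset.sum_congr rfl fun ω₁ _ => ?_
          rw [Finset.sum_comm]
          exact Finset.sum_congr rfl fun x _ => (Finset.sum_mul _ _ _).symm
      _ ≤ ∑ ω₁, ∑ x, μ ω₁ * r x ω₁ := by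
          refine Finset.sum_le_sum fun ω₁ _ => Finset.sum_le_sum fun x _ => ?_
          refine mul_le_of_le_one_left (mul_nonneg (hμ.1 _) (hr _ _).le) ?_
          have := sum_fiber_div_probOf_le_one μ W (Z ω₁, x)
          simpa only [W, Prod.mk.injEq] using this
      _ ≤ ∑ ω₁, μ ω₁ := by
          refine Finset.sum_le_sum fun ω₁ _ => ?_
          rw [← Finset.mul_sum]
          exact mul_le_of_le_one_right (hμ.1 _) (hr1 _)
      _ = 1 := hμ.2
  have key := sum_mul_logb_nonpos hμ hpos hsum
  have split : ∑ ω, μ ω * Real.logb 2 (w ω) =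
      shCondEntropy μ X Z - ∑ ω, μ ω * -Real.logb 2 (r (X ω) ω) := by
    simp only [shCondEntropy, shEntropy, ← Finset.sum_sub_distrib]
    refine Finset.sum_congr rfl fun ω _ => ?_
    rcases (hμ.1 ω).eq_or_lt with h0 | h0
    · simp [← h0]
    · have hz := (probOf_fiber_pos hμ.1 Z h0).ne'
      have hxz := (probOf_fiber_pos hμ.1 W h0).ne'
      simp only [hw]
      rw [Real.logb_div (mul_ne_zero (hr _ _).ne' hz) hxz, Real.logb_mul (hr _ _).ne' hz]
      ring
  linarith

theorem shEntropy_le_logb_card [Fintype T] (hμ : IsPMF μ) (X : Ω → T) :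
    shEntropy μ X ≤ Real.logb 2 (Fintype.card T) := by
  obtain ⟨ω₀⟩ : Nonempty Ω := by
    by_contra hne
    rw [not_nonempty_iff] at hne
    simpa using hμ.2
  have hT : 0 < (Fintype.card T : ℝ) := by
    have : Nonempty T := ⟨X ω₀⟩
    exact_mod_cast Fintype.card_pos
  have h := shCondEntropy_le_sum_neg_logb hμ X (fun _ => ())
    (r := fun _ _ => (Fintype.card T : ℝ)⁻¹) (fun _ _ => inv_pos.2 hT)
    (fun _ => by simp [hT.ne']) (fun _ _ _ _ => rfl)
  rw [shCondEntropy, shEntropy_eq_zero_of_const hμ (X := fun _ => ()) fun _ _ => rfl, sub_zero,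
    shEntropy_congr (Y := X) fun _ _ => by simp] at h
  simpa [← Finset.sum_mul, hμ.2] using h

/-- A form of Fano's inequality, for an estimate `Xhat` of `X` that is determined by `Z`. -/
theorem shCondEntropy_le_of_probOf_ne_le [Fintype T] (hμ : IsPMF μ) {X Xhat : Ω → T} {Z : Ω → R}
    (hdet : ∀ ω ω', Z ω' = Z ω → Xhat ω' = Xhat ω) {ε : ℝ} (hε : 0 < ε) (hε1 : ε < 1)
    (herr : probOf μ {ω | Xhat ω ≠ X ω} ≤ ε) :
    shCondEntropy μ X Z ≤
      -Real.logb 2 (1 - ε) + ε * (Real.logb 2 (Fintype.card T) - Real.logb 2 ε) := by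
  classical
  obtain ⟨ω₀⟩ : Nonempty Ω := by
    by_contra hne
    rw [not_nonempty_iff] at hne
    simpa using hμ.2
  have hT1 : 1 ≤ (Fintype.card T : ℝ) := by
    have : Nonempty T := ⟨X ω₀⟩
    exact_mod_cast Fintype.card_pos
  have hT : 0 < (Fintype.card T : ℝ) := by linarith
  have hlogT : 0 ≤ Real.logb 2 (Fintype.card T) := Real.logb_nonneg one_lt_two hT1
  have hlogε : Real.logb 2 ε ≤ 0 := Real.logb_nonpos one_lt_two hε.le hε1.le
  have hlogε' : Real.logb 2 (1 - ε) ≤ 0 :=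
    Real.logb_nonpos one_lt_two (by linarith) (by linarith)
  have hδ : 0 < ε / Fintype.card T := div_pos hε hT
  have h := shCondEntropy_le_sum_neg_logb hμ X Z
    (r := fun x ω => (if x = Xhat ω then 1 - ε else 0) + ε / Fintype.card T)
    (fun x ω => by split_ifs <;> linarith)
    (fun ω => by
      rw [Finset.sum_add_distrib]
      simp [mul_div_cancel₀ _ hT.ne'])
    (fun x ω ω' hz => by rw [hdet _ _ hz])
  refine h.trans ?_
  have hterm : ∀ ω, μ ω * -Real.logb 2 ((if X ω = Xhat ω then 1 - ε else 0) +
      ε / Fintype.card T) ≤ μ ω * -Real.logb 2 (1 - ε) +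
        (if Xhat ω ≠ X ω then μ ω else 0) *
          (Real.logb 2 (Fintype.card T) - Real.logb 2 ε) := by
    intro ω
    by_cases hx : X ω = Xhat ω
    · simp only [hx, if_true, ne_eq, not_true_eq_false, if_false, zero_mul, add_zero]
      refine mul_le_mul_of_nonneg_left (neg_le_neg ?_) (hμ.1 ω)
      exact Real.logb_le_logb_of_le one_lt_two (by linarith) (by linarith)
    · rw [if_neg hx, if_pos (Ne.symm hx), zero_add, Real.logb_div hε.ne' hT.ne']
      nlinarith [mul_nonneg (hμ.1 ω) (neg_nonneg.2 hlogε')]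
  refine (Finset.sum_le_sum fun ω _ => hterm ω).trans ?_
  rw [Finset.sum_add_distrib, ← Finset.sum_mul, ← Finset.sum_mul, hμ.2, one_mul, ← probOf_setOf]
  have hnonneg : 0 ≤ Real.logb 2 (Fintype.card T) - Real.logb 2 ε := by linarith
  gcongr

end Entropy

section IID

variable {Ω : Type*} [Fintype Ω] {q : Ω → ℝ} {N : ℕ}

theorem sum_pi_prod (f : Fin N → Ω → ℝ) :
    ∑ y : Fin N → Ω, ∏ n, f n (y n) = ∏ n, ∑ ω, f n ω := by
  classical
  rw [Finset.prod_univ_sum, Fintype.piFinset_univ]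

theorem IsPMF.pi (hq : IsPMF q) : IsPMF fun y : Fin N → Ω => ∏ n, q (y n) :=
  ⟨fun _ => Finset.prod_nonneg fun _ _ => hq.1 _, by simp [sum_pi_prod fun _ => q, hq.2]⟩

theorem sum_pi_prod_mul_coord (hq : IsPMF q) (f : Ω → ℝ) (m : Fin N) :
    ∑ y : Fin N → Ω, (∏ n, q (y n)) * f (y m) = ∑ ω, q ω * f ω := by
  classical
  have h : ∀ y : Fin N → Ω, (∏ n, q (y n)) * f (y m) =
      ∏ n, q (y n) * (if n = m then f (y n) else 1) := by
    intro y
    rw [Finset.prod_mul_distrib, Finset.prod_ite_eq' Finset.univ m fun n => f (y n)]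
    simp
  rw [Finset.sum_congr rfl fun y _ => h y,
    sum_pi_prod fun n ω => q ω * (if n = m then f ω else 1), Finset.prod_eq_single m]
  · simp
  · intro n _ hn
    simp [hn, hq.2]
  · simp

theorem probOf_pi_forall (q : Ω → ℝ) (P : Fin N → Ω → Prop) :
    probOf (fun y : Fin N → Ω => ∏ n, q (y n)) {y | ∀ n, P n (y n)} =
      ∏ n, probOf q {ω | P n ω} := by
  classical
  simp only [probOf_setOf]
  rw [← sum_pi_prod]
  refine Finset.sum_congr rfl fun y _ => ?_
  rw [Finset.prod_ite_zero]
  simp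

/-- The entropy of `N` independent copies of a random variable. -/
theorem shEntropy_pi {S : Type*} (hq : IsPMF q) (X : Ω → S) :
    shEntropy (fun y : Fin N → Ω => ∏ n, q (y n)) (fun y n => X (y n)) =
      N * shEntropy q X := by
  have h : ∀ y : Fin N → Ω, (∏ n, q (y n)) *
      -Real.logb 2 (probOf (fun y : Fin N → Ω => ∏ n, q (y n))
        {y' | (fun n => X (y' n)) = fun n => X (y n)}) =
      ∑ m, (∏ n, q (y n)) * -Real.logb 2 (probOf q {ω | X ω = X (y m)}) := by
    intro y
    by_cases h0 : ∏ n, q (y n) = 0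
    · simp [h0]
    · simp only [funext_iff]
      rw [probOf_pi_forall q fun n ω => X ω = X (y n), ← Finset.mul_sum, Finset.sum_neg_distrib]
      congr 2
      refine Real.logb_prod _ _ fun n _ => ?_
      exact (probOf_fiber_pos hq.1 X ((hq.1 _).lt_of_ne'
        (Finset.prod_ne_zero_iff.1 h0 n (Finset.mem_univ n)))).ne'
  rw [shEntropy, Finset.sum_congr rfl fun y _ => h y, Finset.sum_comm,
    Finset.sum_congr rfl fun m _ => sum_pi_prod_mul_coord hq
      (fun ω => -Real.logb 2 (probOf q {ω' | X ω' = X ω})) m]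
  simp [shEntropy]

theorem probOf_pi_fst {A B : Type*} [Fintype A] [Fintype B] {p : A → ℝ} {q : A × B → ℝ}
    (hmarg : ∀ a, ∑ b, q (a, b) = p a) (P : (Fin N → A) → Prop) :
    probOf (fun y : Fin N → A × B => ∏ n, q (y n)) {y | P fun n => (y n).1} =
      probOf (fun y : Fin N → A => ∏ n, p (y n)) {y | P y} := by
  classical
  simp only [probOf_setOf]
  rw [← (Equiv.arrowProdEquivProdArrow (Fin N) (fun _ => A) (fun _ => B)).symm.sum_comp,
    Fintype.sum_prod_type]
  refine Finset.sum_congr rfl fun a _ => ?_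
  change (∑ b : Fin N → B, if P a then ∏ n, q (a n, b n) else 0) = _
  split_ifs with h
  · rw [sum_pi_prod fun n b => q (a n, b)]
    simp only [hmarg]
  · exact Finset.sum_const_zero

end IID

/-- The normalized joint entropy of a subfamily of random variables. -/
noncomputable def jointEntropyRate {Ω Z : Type*} [Fintype Ω] {T : Z → Type*} (μ : Ω → ℝ)
    (X : ∀ z, Ω → T z) (N : ℕ) (A : Finset Z) : ℝ :=
  shEntropy μ (fun ω (z : A) => X z ω) / N

section JointEntropy

variable {Ω Z : Type*} {T : Z → Type*}

theorem restrict_eq_iff (X : ∀ z, Ω → T z) (A : Finset Z) (ω ω' : Ω) :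
    ((fun z : A => X z ω') = fun z : A => X z ω) ↔ ∀ z ∈ A, X z ω' = X z ω := by
  simp [funext_iff]

variable [Fintype Ω] {μ : Ω → ℝ}

theorem isPolymatroid_jointEntropyRate [DecidableEq Z] (hμ : IsPMF μ) (X : ∀ z, Ω → T z) (N : ℕ) :
    IsPolymatroid (jointEntropyRate μ X N) := by
  refine ⟨?_, fun A => div_nonneg (shEntropy_nonneg hμ _) N.cast_nonneg, fun A B hAB => ?_,
    fun A B => ?_⟩
  · rw [jointEntropyRate, shEntropy_eq_zero_of_const hμ, zero_div]
    simp [funext_iff]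
  · refine div_le_div_of_nonneg_right (shEntropy_mono hμ fun ω ω' => ?_) N.cast_nonneg
    simp only [restrict_eq_iff]
    exact fun h z hz => h z (hAB hz)
  · simp only [jointEntropyRate, ← add_div]
    refine div_le_div_of_nonneg_right ?_ N.cast_nonneg
    have h := shEntropy_submodular hμ (X := fun ω (z : A) => X z ω) (Y := fun ω (z : B) => X z ω)
      (Z := fun ω (z : ↥(A ∩ B)) => X z ω)
      (fun ω ω' => by
        simp only [restrict_eq_iff]
        exact fun h z hz => h z (Finset.mem_inter.1 hz).1)
      (fun ω ω' => by
        simp only [restrict_eq_iff]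
        exact fun h z hz => h z (Finset.mem_inter.1 hz).2)
    rwa [shEntropy_congr (X := fun ω => ((fun z : A => X z ω), fun z : B => X z ω))
      (Y := fun ω (z : ↥(A ∪ B)) => X z ω)] at h
    intro ω ω'
    simp only [Prod.mk.injEq, restrict_eq_iff, Finset.mem_union, or_imp, forall_and]

theorem jointEntropyRate_insert_eq [DecidableEq Z] (X : ∀ z, Ω → T z) (N : ℕ) {A : Finset Z}
    {z : Z} (h : ∀ ω ω', (∀ z' ∈ A, X z' ω' = X z' ω) → X z ω' = X z ω) :
    jointEntropyRate μ X N (insert z A) = jointEntropyRate μ X N A := by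
  rw [jointEntropyRate, jointEntropyRate, shEntropy_congr]
  intro ω ω'
  simp only [restrict_eq_iff, Finset.forall_mem_insert]
  exact ⟨fun h' => h'.2, fun h' => ⟨h ω ω' h', h'⟩⟩

end JointEntropy

section Network

variable {V S E L : Type} [Fintype S] [Fintype E] [DecidableEq S] [DecidableEq E] [DecidableEq L]
  {net : Network V S E}

theorem forall_mem_atNode' {u : V} {P : S ⊕ E ⊕ L → Prop} :
    (∀ z ∈ atNode' (L := L) net u, P z) ↔
      (∀ s, u ∈ net.src s → P (Sum.inl s)) ∧ ∀ f, net.head f = u → P (Sum.inr (Sum.inl f)) := by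
  simp [atNode', or_imp, forall_and]

theorem inEdges'_eq_atNode' (e : E) :
    inEdges' (L := L) net e = atNode' net (net.tail e) := rfl

/-- The value types of the blocks of sources, edge messages and auxiliary variables. -/
def NetworkCode.Val {𝒴 : S → Type} {N : ℕ} (code : NetworkCode net 𝒴 N) (𝒦 : L → Type) :
    S ⊕ E ⊕ L → Type
  | Sum.inl s => Fin N → 𝒴 s
  | Sum.inr (Sum.inl e) => code.U e
  | Sum.inr (Sum.inr i) => Fin N → 𝒦 i

/-- The blocks of sources, edge messages and auxiliary variables as random variables. -/
def NetworkCode.rv {𝒴 : S → Type} {N : ℕ} (code : NetworkCode net 𝒴 N) (𝒦 : L → Type) :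
    ∀ z : S ⊕ E ⊕ L, (Fin N → (∀ s, 𝒴 s) × (∀ i, 𝒦 i)) → code.Val 𝒦 z
  | Sum.inl s, y => fun n => (y n).1 s
  | Sum.inr (Sum.inl e), y => code.g e fun s n => (y n).1 s
  | Sum.inr (Sum.inr i), y => fun n => (y n).2 i

/-- The Fano correction per source letter, as a function of the error probability. -/
noncomputable def fanoTerm (M ε : ℝ) : ℝ :=
  -Real.logb 2 (1 - ε) + ε * (Real.logb 2 M - Real.logb 2 ε)

theorem tendsto_fanoTerm (M : ℝ) {u : ℕ → ℝ} (hu : Filter.Tendsto u Filter.atTop (nhds 0)) :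
    Filter.Tendsto (fun n => fanoTerm M (u n)) Filter.atTop (nhds 0) := by
  have hcont : ContinuousAt (fun ε : ℝ => -(Real.log (1 - ε) / Real.log 2) +
      (ε * Real.logb 2 M - ε * Real.log ε / Real.log 2)) 0 := by
    have h1 : ContinuousAt (fun ε : ℝ => Real.log (1 - ε)) 0 :=
      ContinuousAt.log (by fun_prop) (by norm_num)
    have h2 : ContinuousAt (fun ε : ℝ => ε * Real.log ε) 0 :=
      Real.continuous_mul_log.continuousAt
    exact (h1.div_const _).neg.add ((continuousAt_id.mul_const _).sub (h2.div_const _))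
  have h := hcont.tendsto.comp hu
  have h0 : -(Real.log (1 - 0) / Real.log 2) +
      ((0 : ℝ) * Real.logb 2 M - 0 * Real.log 0 / Real.log 2) = 0 := by simp
  rw [h0] at h
  refine h.congr fun n => ?_
  simp only [Function.comp_apply, fanoTerm, Real.logb]
  ring

/-- A block code of small error probability yields a polymatroid satisfying the decoding and
capacity constraints approximately and all others exactly. -/
theorem NetworkCode.exists_polymatroid {𝒴 : S → Type} [∀ s, Fintype (𝒴 s)]
    {𝒦 : L → Type} [Fintype (∀ i, 𝒦 i)] {p : (∀ s, 𝒴 s) → ℝ}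
    {q : ((∀ s, 𝒴 s) × (∀ i, 𝒦 i)) → ℝ} (hq : IsPMF q)
    (hmarg : ∀ y : ∀ s, 𝒴 s, (∑ k : ∀ i, 𝒦 i, q (y, k)) = p y)
    {N : ℕ} (hN : 0 < N) (code : NetworkCode net 𝒴 N) {C : E → ℝ} {ε : ℝ} (hε : 0 < ε)
    (hε1 : ε < 1)
    (hrate : ∀ e : E, Real.logb 2 (@Fintype.card (code.U e) (code.fintU e)) / N ≤ C e + ε)
    (herr : ∀ s : S, ∀ u ∈ net.snk s, errProb net p code s u ≤ ε) :
    ∃ h : Finset (S ⊕ E ⊕ L) → ℝ, IsPolymatroid h ∧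
      (∀ (α : Finset S) (β : Finset L),
        h (α.image Sum.inl ∪ β.image (Sum.inr ∘ Sum.inr)) =
          shEntropy q (fun yk =>
            ((fun s : {x // x ∈ α} => yk.1 s.1), (fun i : {x // x ∈ β} => yk.2 i.1)))) ∧
      (∀ e : E, h (insert (Sum.inr (Sum.inl e)) (inEdges' (L := L) net e)) =
        h (inEdges' (L := L) net e)) ∧
      (∀ s : S, ∀ u ∈ net.snk s,
        h (insert (Sum.inl s) (atNode' (L := L) net u)) ≤
          h (atNode' (L := L) net u) + fanoTerm (Fintype.card (𝒴 s)) ε) ∧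
      (∀ e : E, h {Sum.inr (Sum.inl e)} ≤ C e + ε) ∧
      ∀ A, h A ≤ shEntropy q id := by
  have hN0 : (N : ℝ) ≠ 0 := by exact_mod_cast hN.ne'
  have hN1 : (1 : ℝ) ≤ N := by exact_mod_cast hN
  have hμ : IsPMF fun y : Fin N → (∀ s, 𝒴 s) × (∀ i, 𝒦 i) => ∏ n, q (y n) := hq.pi
  refine ⟨jointEntropyRate _ (code.rv 𝒦) N, isPolymatroid_jointEntropyRate hμ _ N,
    fun α β => ?_, fun e => ?_, fun s u hu => ?_, fun e => ?_, fun A => ?_⟩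
  · rw [jointEntropyRate, div_eq_iff hN0, mul_comm, ← shEntropy_pi hq]
    refine shEntropy_congr fun y y' => ?_
    rw [restrict_eq_iff]
    simp only [Finset.forall_mem_union, Finset.forall_mem_image, Function.comp_apply,
      funext_iff, Prod.mk.injEq, Subtype.forall]
    exact ⟨fun h n => ⟨fun s hs => congrFun (h.1 hs) n, fun i hi => congrFun (h.2 hi) n⟩,
      fun h => ⟨fun s hs => funext fun n => (h n).1 s hs,
        fun i hi => funext fun n => (h n).2 i hi⟩⟩
  · refine jointEntropyRate_insert_eq _ _ fun y y' h => ?_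
    rw [inEdges'_eq_atNode', forall_mem_atNode'] at h
    obtain ⟨φ, hφ⟩ := code.localEnc e
    simp only [NetworkCode.rv] at h ⊢
    rw [hφ, hφ]
    congr 1
    · funext s
      exact h.1 s.1 s.2
    · funext f
      exact h.2 f.1 f.2
  · let Xhat : (Fin N → (∀ s, 𝒴 s) × (∀ i, 𝒦 i)) → Fin N → 𝒴 s := fun y =>
      code.dec s u (fun s' n => (y n).1 s'.1) (fun f => code.g f.1 fun s'' n => (y n).1 s'')
    have hfano := shCondEntropy_le_of_probOf_ne_le hμ (X := fun y n => (y n).1 s) (Xhat := Xhat)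
      (Z := fun y (z : atNode' (L := L) net u) => code.rv 𝒦 z y)
      (fun y y' h => by
        rw [restrict_eq_iff, forall_mem_atNode'] at h
        simp only [NetworkCode.rv] at h
        simp only [Xhat]
        congr 1
        · funext s
          exact h.1 s.1 s.2
        · funext f
          exact h.2 f.1 f.2) hε hε1
      ((probOf_pi_fst hmarg fun y => code.dec s u (fun s' n => y n s'.1)
          (fun f => code.g f.1 fun s'' n => y n s'') ≠ fun n => y n s).trans_le (herr s u hu))
    rw [shCondEntropy, shEntropy_congr
      (Y := fun y (z : ↥(insert (Sum.inl s) (atNode' (L := L) net u))) => code.rv 𝒦 z y)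
      fun y y' => by
        simp only [Prod.mk.injEq, restrict_eq_iff, Finset.forall_mem_insert]
        exact and_comm] at hfano
    rw [jointEntropyRate, jointEntropyRate, ← sub_le_iff_le_add', ← sub_div,
      div_le_iff₀ (by linarith)]
    refine hfano.trans ?_
    have hlogε : Real.logb 2 ε ≤ 0 := Real.logb_nonpos one_lt_two hε.le hε1.le
    have hlogε' : Real.logb 2 (1 - ε) ≤ 0 :=
      Real.logb_nonpos one_lt_two (by linarith) (by linarith)
    simp only [Fintype.card_pi, Finset.prod_const, Finset.card_univ, Fintype.card_fin,
      Nat.cast_pow, Real.logb_pow, fanoTerm]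
    nlinarith [mul_nonneg (sub_nonneg.2 hN1) (neg_nonneg.2 hlogε'),
      mul_nonneg (mul_nonneg hε.le (sub_nonneg.2 hN1)) (neg_nonneg.2 hlogε)]
  · refine le_trans ?_ (hrate e)
    refine div_le_div_of_nonneg_right ?_ N.cast_nonneg
    let _ := code.fintU e
    rw [shEntropy_congr (Y := fun y => code.g e fun s n => (y n).1 s)]
    · exact shEntropy_le_logb_card hμ _
    · intro y y'
      rw [restrict_eq_iff]
      simp only [Finset.mem_singleton, forall_eq, NetworkCode.rv]
      exact Iff.rfl
  · rw [jointEntropyRate, div_le_iff₀ (by linarith), mul_comm, ← shEntropy_pi hq]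
    refine shEntropy_mono hμ fun y y' h => ?_
    have : y' = y := h
    rw [this]

end Network

/-- improved LP outer bound via auxiliary random variables,
Theorem 2 of the paper: let `K_i, i ∈ L` be auxiliary random variables jointly
distributed with the sources via an arbitrary conditional distribution, i.e. a
joint pmf `q` on sources × auxiliaries whose source marginal is the source
distribution `p`.  If `C` is achievable then there is a polymatroid `h` on
`S ⊕ E ⊕ L` matching the joint entropies `H(Y_α, K_β)` for all `α ⊆ S`,
`β ⊆ L`, respecting the encoding and decoding functional constraints, and with
`h(e) ≤ C e`; i.e. `R_cs ⊆ R*_cs(Γ) (⊆ R_cs(Γ))`. -/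
theorem achievable_implies_improved_LP_outer_bound
    {V S E L : Type} [Fintype S] [Fintype E] [Fintype L]
    [DecidableEq S] [DecidableEq E] [DecidableEq L]
    (net : Network V S E) (𝒴 : S → Type) [∀ s, Fintype (𝒴 s)]
    (𝒦 : L → Type) [∀ i, Fintype (𝒦 i)] [DecidableEq L]
    (p : (∀ s, 𝒴 s) → ℝ) (hp : IsPMF p)
    (q : ((∀ s, 𝒴 s) × (∀ i, 𝒦 i)) → ℝ) (hq : IsPMF q)
    (hmarg : ∀ y : ∀ s, 𝒴 s, (∑ k : ∀ i, 𝒦 i, q (y, k)) = p y)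
    (C : E → ℝ) (hCpos : ∀ e, 0 < C e)
    (hach : Achievable net 𝒴 p C) :
    ∃ h : Finset (S ⊕ E ⊕ L) → ℝ, IsPolymatroid h ∧
      (∀ (α : Finset S) (β : Finset L),
        h (α.image Sum.inl ∪ β.image (Sum.inr ∘ Sum.inr)) =
          shEntropy q (fun yk =>
            ((fun s : {x // x ∈ α} => yk.1 s.1), (fun i : {x // x ∈ β} => yk.2 i.1)))) ∧
      (∀ e : E, h (insert (Sum.inr (Sum.inl e)) (inEdges' (L := L) net e)) =
        h (inEdges' (L := L) net e)) ∧
      (∀ s : S, ∀ u ∈ net.snk s,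
        h (insert (Sum.inl s) (atNode' (L := L) net u)) = h (atNode' (L := L) net u)) ∧
      (∀ e : E, h {Sum.inr (Sum.inl e)} ≤ C e) := by
  set ε : ℕ → ℝ := fun n => 1 / ((n : ℝ) + 2) with hε
  have hεpos : ∀ n, 0 < ε n := fun n => by positivity
  have hε1 : ∀ n, ε n < 1 := fun n => by
    rw [hε, div_lt_one (by positivity)]
    linarith [(n.cast_nonneg : (0 : ℝ) ≤ n)]
  have hεlim : Filter.Tendsto ε Filter.atTop (nhds 0) := by
    refine (tendsto_const_nhds (x := (1 : ℝ))).div_atTop ?_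
    exact Filter.tendsto_atTop_add_const_right _ _ tendsto_natCast_atTop_atTop
  choose N hN code hrate herr using fun n => hach (ε n) (hεpos n)
  choose H hpoly hent henc hdec hcap hbd using fun n =>
    (code n).exists_polymatroid hq hmarg (hN n) (hεpos n) (hε1 n) (hrate n) (herr n)
  obtain ⟨h, -, φ, hφ, hlim⟩ := (isCompact_univ_pi
    fun _ : Finset (S ⊕ E ⊕ L) => isCompact_Icc (a := (0 : ℝ)) (b := shEntropy q id)).tendsto_subseq
      (x := H) fun n A _ => ⟨(hpoly n).2.1 A, hbd n A⟩
  have hA : ∀ A, Filter.Tendsto (fun n => H (φ n) A) Filter.atTop (nhds (h A)) :=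
    fun A => (tendsto_pi_nhds.1 hlim) A
  have hεφ := hεlim.comp hφ.tendsto_atTop
  refine ⟨h, ⟨?_, fun A => ?_, fun A B hAB => ?_, fun A B => ?_⟩, fun α β => ?_, fun e => ?_,
    fun s u hu => le_antisymm ?_ ?_, fun e => ?_⟩
  · exact tendsto_nhds_unique (hA ∅) (by simp [(hpoly _).1])
  · exact ge_of_tendsto' (hA A) fun n => (hpoly _).2.1 A
  · exact le_of_tendsto_of_tendsto' (hA A) (hA B) fun n => (hpoly _).2.2.1 A B hAB
  · exact le_of_tendsto_of_tendsto' ((hA _).add (hA _)) ((hA A).add (hA B))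
      fun n => (hpoly _).2.2.2 A B
  · refine tendsto_nhds_unique (hA _) ?_
    simp only [hent]
    exact tendsto_const_nhds
  · refine tendsto_nhds_unique (hA _) ?_
    simp only [henc]
    exact hA _
  · have hR := (hA (atNode' net u)).add (tendsto_fanoTerm (Fintype.card (𝒴 s)) hεφ)
    rw [add_zero] at hR
    exact le_of_tendsto_of_tendsto' (hA _) hR fun n => hdec (φ n) s u hu
  · exact le_of_tendsto_of_tendsto' (hA _) (hA _)
      fun n => (hpoly _).2.2.1 _ _ (Finset.subset_insert _ _)
  · have hR := hεφ.const_add (C e)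
    rw [add_zero] at hR
    exact le_of_tendsto_of_tendsto' (hA _) hR fun n => hcap (φ n) e
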